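/- Let φ : Σ^{ℓ+1} → Σ be a local transition rule, and define the global rule φ̂ on configurations a : ℤ → Σ by φ̂(a)_x = φ(a_{x−ℓ}, a_{x−ℓ+1}, …, a_x). Then φ̂ is number-conserving (i.e., for every configuration a with finite particle content, φ̂(a) has finite particle content and #φ̂(a) = #a) if and only if there exists a function f : Σ^ℓ → ℤ such that for every w = w_0…w_ℓ ∈ Σ^{ℓ+1}, #φ(w) = f(w_{0:ℓ}) + #w_ℓ − f(w_{1:ℓ}), where w_{0:ℓ} = w_0…w_{ℓ−1} and w_{1:ℓ} = w_1…w_ℓ. -/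

import Mathlib

/-- The state set `Σ = {0, 1, …, C}`. -/
abbrev St (C : ℕ) := Fin (C + 1)

/-- Particle content `#w` of a string `w ∈ Σ^n`. -/
def content {C n : ℕ} (w : Fin n → St C) : ℤ := ∑ i, (w i : ℤ)

/-- The prefix `w_{0:k}` of a string `w ∈ Σ^{k+1}`. -/
def prefixStr {C k : ℕ} (w : Fin (k + 1) → St C) : Fin k → St C :=
  fun i => w i.castSucc

/-- The suffix `w_{1:k}` of a string `w ∈ Σ^{k+1}`. -/
def suffixStr {C k : ℕ} (w : Fin (k + 1) → St C) : Fin k → St C :=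
  fun i => w i.succ

/-- `f : Σ^ℓ → ℤ` is a flow function of width `ℓ`:
`0 ≤ f(w_{0:ℓ}) + #w_ℓ − f(w_{1:ℓ}) ≤ C` for all `w ∈ Σ^{ℓ+1}`. -/
def IsFlow (C ℓ : ℕ) (f : (Fin ℓ → St C) → ℤ) : Prop :=
  ∀ w : Fin (ℓ + 1) → St C,
    0 ≤ f (prefixStr w) + (w (Fin.last ℓ) : ℤ) - f (suffixStr w) ∧
      f (prefixStr w) + (w (Fin.last ℓ) : ℤ) - f (suffixStr w) ≤ (C : ℤ)

/-- A configuration `a : ℤ → Σ` has finite particle content if only finitely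
many cells are in a state with non-zero content. -/
def FiniteContent {C : ℕ} (a : ℤ → St C) : Prop := {x : ℤ | a x ≠ 0}.Finite

/-- The total particle content `#a` of a configuration. -/
noncomputable def totContent {C : ℕ} (a : ℤ → St C) : ℤ := ∑ᶠ x : ℤ, (a x : ℤ)

/-- The neighbourhood `(a_{x−ℓ}, …, a_x)` of the boundary at `x`. -/
def nbhd {C : ℕ} (ℓ : ℕ) (a : ℤ → St C) (x : ℤ) : Fin (ℓ + 1) → St C :=
  fun i => a (x - (ℓ : ℤ) + (i : ℕ))

/-- The global transition rule `φ̂` induced by a local rule `φ` with left radius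
`ℓ` and right radius `0`: `φ̂(a)_x = φ(a_{x−ℓ}, …, a_x)`. -/
def globalRule {C : ℕ} (ℓ : ℕ) (φ : (Fin (ℓ + 1) → St C) → St C) (a : ℤ → St C) : ℤ → St C :=
  fun x => φ (nbhd ℓ a x)

/-- The configuration carrying the string `u` on cells `0, …, n-1`, zero elsewhere. -/
def embStr {C n : ℕ} (u : Fin n → St C) : ℤ → St C :=
  fun x => if h : 0 ≤ x ∧ x < n then u ⟨x.toNat, by omega⟩ else 0

theorem embStr_of {C n : ℕ} (u : Fin n → St C) (i : Fin n) (x : ℤ) (h : x = (i : ℕ)) :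
    embStr u x = u i := by
  subst h
  have := i.2
  unfold embStr
  rw [dif_pos (by omega)]
  congr 1

theorem embStr_out {C n : ℕ} (u : Fin n → St C) (x : ℤ) (h : ¬ (0 ≤ x ∧ x < n)) :
    embStr u x = 0 := dif_neg h

theorem embStr_finite {C n : ℕ} (u : Fin n → St C) : FiniteContent (embStr u) := by
  refine (Set.finite_Ico (0 : ℤ) n).subset ?_
  intro x hx
  by_contra h
  exact hx (embStr_out u x h)

theorem embStr_eq_pre {C n : ℕ} (w : Fin (n + 1) → St C) (x : ℤ) (h : x < n) :
    embStr w x = embStr (prefixStr w) x := by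
  by_cases h0 : 0 ≤ x
  · rw [embStr_of (prefixStr w) ⟨x.toNat, by omega⟩ x (by simp; omega),
      embStr_of w ⟨x.toNat, by omega⟩ x (by simp; omega)]
    rfl
  · rw [embStr_out _ _ (by omega), embStr_out _ _ (by omega)]

theorem embStr_eq_suf {C n : ℕ} (w : Fin (n + 1) → St C) (x : ℤ) (h : 1 ≤ x) :
    embStr w x = embStr (suffixStr w) (x - 1) := by
  by_cases h0 : x < n + 1
  · rw [embStr_of (suffixStr w) ⟨(x - 1).toNat, by omega⟩ (x - 1) (by simp; omega),
      embStr_of w ⟨(x - 1).toNat + 1, by omega⟩ x (by simp; omega)]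
    rfl
  · rw [embStr_out _ _ (by push_cast; omega), embStr_out _ _ (by omega)]

theorem FiniteContent.support {C : ℕ} {a : ℤ → St C} (h : FiniteContent a) :
    (Function.support fun x => (a x : ℤ)).Finite := by
  refine Set.Finite.subset h ?_
  intro x hx h0
  apply hx
  simp [h0]

theorem finite_window {C : ℕ} {a : ℤ → St C} (h : FiniteContent a) (n : ℕ) (m : ℤ) :
    {x : ℤ | ∃ i : Fin n, a (x - m + (i : ℕ)) ≠ 0}.Finite := by
  have : {x : ℤ | ∃ i : Fin n, a (x - m + (i : ℕ)) ≠ 0} =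
      ⋃ i : Fin n, (fun x : ℤ => x - m + (i : ℕ)) ⁻¹' {x : ℤ | a x ≠ 0} := by
    ext x; simp
  rw [this]
  refine Set.finite_iUnion fun i => Set.Finite.preimage ?_ h
  intro x _ y _ hxy
  simpa using hxy

theorem conserving_of_flow {C ℓ : ℕ} (φ : (Fin (ℓ + 1) → St C) → St C)
    (f : (Fin ℓ → St C) → ℤ)
    (hf : ∀ w : Fin (ℓ + 1) → St C,
        (φ w : ℤ) = f (prefixStr w) + (w (Fin.last ℓ) : ℤ) - f (suffixStr w))
    (a : ℤ → St C) (ha : FiniteContent a) :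
    FiniteContent (globalRule ℓ φ a) ∧ totContent (globalRule ℓ φ a) = totContent a := by
  have hφ0 : φ (fun _ => 0) = 0 := by
    have h := hf (fun _ => 0)
    have e : prefixStr (fun _ : Fin (ℓ + 1) => (0 : St C)) = suffixStr (fun _ => 0) := rfl
    rw [e] at h
    simp at h
    exact h
  constructor
  · refine (finite_window ha (ℓ + 1) ℓ).subset ?_
    intro x hx
    by_contra hn
    simp only [Set.mem_ofPred_eq, not_exists, not_not] at hn
    apply hx
    have : nbhd ℓ a x = fun _ => 0 := funext hn
    simp [globalRule, this, hφ0]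
  · set g : ℤ → ℤ := fun x => f (fun i => a (x - ℓ + (i : ℕ))) - f (fun _ => 0) with hg
    have hgs : (Function.support g).Finite := by
      refine (finite_window ha ℓ ℓ).subset ?_
      intro x hx
      by_contra hn
      simp only [Set.mem_ofPred_eq, not_exists, not_not] at hn
      apply hx
      simp [hg, hn]
    have hgs' : (Function.support fun x => g (x + 1)).Finite :=
      Set.Finite.preimage (f := fun x : ℤ => x + 1) (add_left_injective 1).injOn hgs
    have hshift : ∑ᶠ x, g (x + 1) = ∑ᶠ x, g x := finsum_comp_equiv (Equiv.addRight (1 : ℤ))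
    have key : ∀ x, (globalRule ℓ φ a x : ℤ) = g x + (a x : ℤ) - g (x + 1) := by
      intro x
      have h1 : prefixStr (nbhd ℓ a x) = fun i : Fin ℓ => a (x - ℓ + (i : ℕ)) := rfl
      have h2 : suffixStr (nbhd ℓ a x) = fun i : Fin ℓ => a (x + 1 - ℓ + (i : ℕ)) := by
        funext i
        simp only [suffixStr, nbhd, Fin.val_succ]
        congr 1
        push_cast
        ring
      have h3 : nbhd ℓ a x (Fin.last ℓ) = a x := by simp [nbhd]
      have := hf (nbhd ℓ a x)
      rw [h1, h2, h3] at this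
      simp only [globalRule, this, hg]
      ring
    unfold totContent
    simp only [key]
    rw [finsum_sub_distrib _ hgs', finsum_add_distrib hgs ha.support, hshift]
    · ring
    · exact (hgs.union ha.support).subset (Function.support_add _ _)

theorem flow_of_conserving {C ℓ : ℕ} (φ : (Fin (ℓ + 1) → St C) → St C)
    (h : ∀ a : ℤ → St C, FiniteContent a →
        FiniteContent (globalRule ℓ φ a) ∧ totContent (globalRule ℓ φ a) = totContent a)
    (w : Fin (ℓ + 1) → St C) :
    (φ w : ℤ) =
      (∑ᶠ x : ℤ, if (ℓ : ℤ) ≤ x then (globalRule ℓ φ (embStr (prefixStr w)) x : ℤ) else 0)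
      + (w (Fin.last ℓ) : ℤ) -
      ∑ᶠ x : ℤ, if (ℓ : ℤ) ≤ x then (globalRule ℓ φ (embStr (suffixStr w)) x : ℤ) else 0 := by
  obtain ⟨hb, hb'⟩ := h _ (embStr_finite w)
  obtain ⟨hd, hd'⟩ := h _ (embStr_finite (prefixStr w))
  obtain ⟨he, -⟩ := h _ (embStr_finite (suffixStr w))
  replace hb := hb.support
  replace hd := hd.support
  replace he := he.support
  have hQ1 : ∀ x : ℤ, x < ℓ →
      globalRule ℓ φ (embStr w) x = globalRule ℓ φ (embStr (prefixStr w)) x := by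
    intro x hx
    simp only [globalRule]
    congr 1
    funext i
    have := i.2
    exact embStr_eq_pre w _ (by omega)
  have hQ2 : globalRule ℓ φ (embStr w) ℓ = φ w := by
    simp only [globalRule]
    congr 1
    funext i
    exact embStr_of w i _ (by ring)
  have hQ3 : ∀ x : ℤ, (ℓ : ℤ) ≤ x - 1 →
      globalRule ℓ φ (embStr w) x = globalRule ℓ φ (embStr (suffixStr w)) (x - 1) := by
    intro x hx
    simp only [globalRule]
    congr 1
    funext i
    simp only [nbhd]
    rw [embStr_eq_suf w _ (by omega)]
    congr 1
    ring
  have hB : ∀ x : ℤ, (embStr w x : ℤ) =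
      (embStr (prefixStr w) x : ℤ) + if x = ℓ then (w (Fin.last ℓ) : ℤ) else 0 := by
    intro x
    rcases lt_trichotomy x (ℓ : ℤ) with hx | hx | hx
    · rw [embStr_eq_pre w x hx, if_neg hx.ne, add_zero]
    · rw [embStr_of w (Fin.last ℓ) x (by simpa using hx), embStr_out _ _ (by omega), if_pos hx]
      simp
    · rw [embStr_out w _ (by push_cast; omega), embStr_out _ _ (by omega), if_neg hx.ne']
      simp
  generalize globalRule ℓ φ (embStr w) = Q at *
  generalize globalRule ℓ φ (embStr (prefixStr w)) = P at *
  generalize globalRule ℓ φ (embStr (suffixStr w)) = R at *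
  have hsing : ∀ c : ℤ, (Function.support fun x : ℤ => if x = ℓ then c else 0).Finite := by
    intro c
    refine (Set.finite_singleton (ℓ : ℤ)).subset ?_
    intro x hx
    by_contra hn
    simp at hn
    simp [hn] at hx
  have hsum : ∀ c : ℤ, ∑ᶠ x : ℤ, (if x = ℓ then c else 0) = c := by
    intro c
    rw [finsum_eq_single _ (ℓ : ℤ) (fun x hx => if_neg hx), if_pos rfl]
  have hP1 : (Function.support fun x : ℤ => if x < ℓ then (P x : ℤ) else 0).Finite := by
    refine hd.subset ?_
    intro x hx h0
    apply hx
    simp only at h0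
    simp only [h0, ite_self]
  have hP2 : (Function.support fun x : ℤ => if (ℓ : ℤ) ≤ x then (P x : ℤ) else 0).Finite := by
    refine hd.subset ?_
    intro x hx h0
    apply hx
    simp only at h0
    simp only [h0, ite_self]
  have hR : (Function.support fun x : ℤ => if (ℓ : ℤ) ≤ x then (R x : ℤ) else 0).Finite := by
    refine he.subset ?_
    intro x hx h0
    apply hx
    simp only at h0
    simp only [h0, ite_self]
  have hR' : (Function.support
      fun x : ℤ => if (ℓ : ℤ) ≤ x - 1 then (R (x - 1) : ℤ) else 0).Finite :=
    Set.Finite.preimage (f := fun x : ℤ => x - 1) (sub_left_injective).injOn hR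
  have hshift : ∑ᶠ x : ℤ, (if (ℓ : ℤ) ≤ x - 1 then (R (x - 1) : ℤ) else 0) =
      ∑ᶠ x : ℤ, if (ℓ : ℤ) ≤ x then (R x : ℤ) else 0 :=
    finsum_comp_equiv (f := fun x : ℤ => if (ℓ : ℤ) ≤ x then (R x : ℤ) else 0)
      (Equiv.subRight (1 : ℤ))
  have e1 : totContent Q = (∑ᶠ x : ℤ, if x < ℓ then (P x : ℤ) else 0) + (φ w : ℤ) +
      ∑ᶠ x : ℤ, if (ℓ : ℤ) ≤ x then (R x : ℤ) else 0 := by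
    rw [← hshift]
    conv_rhs => rw [← hsum (φ w : ℤ)]
    rw [← finsum_add_distrib hP1 (hsing _), ← finsum_add_distrib _ hR']
    · refine finsum_congr fun x => ?_
      rcases lt_trichotomy x (ℓ : ℤ) with hx | hx | hx
      · rw [if_pos hx, if_neg hx.ne, if_neg (by omega), hQ1 x hx]
        simp
      · subst hx
        simp [hQ2]
      · rw [if_neg (by omega), if_neg (by omega), if_pos (by omega), hQ3 x (by omega)]
        simp
    · exact (hP1.union (hsing _)).subset (Function.support_add _ _)
  have e2 : totContent P = (∑ᶠ x : ℤ, if x < ℓ then (P x : ℤ) else 0) +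
      ∑ᶠ x : ℤ, if (ℓ : ℤ) ≤ x then (P x : ℤ) else 0 := by
    rw [← finsum_add_distrib hP1 hP2]
    refine finsum_congr fun x => ?_
    by_cases hx : x < (ℓ : ℤ)
    · simp [hx, not_le.mpr hx]
    · simp [hx, not_lt.mp hx]
  have e3 : totContent (embStr w) = totContent (embStr (prefixStr w)) +
      (w (Fin.last ℓ) : ℤ) := by
    unfold totContent
    simp only [hB]
    rw [finsum_add_distrib (embStr_finite (prefixStr w)).support (hsing _), hsum]
  linarith

/-- A cellular automaton is number-conserving if and only if it has a flow
function: `#φ(w) = f(w_{0:ℓ}) + #w_ℓ − f(w_{1:ℓ})` for all `w ∈ Σ^{ℓ+1}`. -/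
theorem number_conserving_iff_flow (C ℓ : ℕ) (hC : 1 ≤ C) (hℓ : 1 ≤ ℓ)
    (φ : (Fin (ℓ + 1) → St C) → St C) :
    (∀ a : ℤ → St C, FiniteContent a →
        FiniteContent (globalRule ℓ φ a) ∧ totContent (globalRule ℓ φ a) = totContent a) ↔
      ∃ f : (Fin ℓ → St C) → ℤ, ∀ w : Fin (ℓ + 1) → St C,
        (φ w : ℤ) = f (prefixStr w) + (w (Fin.last ℓ) : ℤ) - f (suffixStr w) := by
  constructor
  · intro h
    exact ⟨fun u => ∑ᶠ x : ℤ, if (ℓ : ℤ) ≤ x then (globalRule ℓ φ (embStr u) x : ℤ) else 0,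
      fun w => flow_of_conserving φ h w⟩
  · rintro ⟨f, hf⟩ a ha
    exact conserving_of_flow φ f hf a ha
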